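/- Let f ∈ 𝒮(ℝ) be a complex-valued Schwartz function with Fourier transform f̂(ξ) = (1/√(2π)) ∫_ℝ e^{−iβξ} f(β) dβ. Then for every α ∈ ℝ the limit lim_{ε → 0⁺} (1/π) ∫_{{β : |α − β| ≥ ε}} (f(α) − f(β))/(α − β)² dβ exists and equals (1/√(2π)) ∫_ℝ e^{iαξ} |ξ| f̂(ξ) dξ, i.e. the value at α of the Fourier multiplier operator |∂_{α'}| with symbol |ξ| applied to f. -/

import Mathlib

open MeasureTheory Complex
open scoped ENNReal NNReal

/-- The Fourier transform with the convention `f̂(ξ) = (1/√(2π)) ∫ e^{−iβξ} f(β) dβ`. -/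
noncomputable def fourierT (f : ℝ → ℂ) (ξ : ℝ) : ℂ :=
  ((1 / Real.sqrt (2 * Real.pi) : ℝ) : ℂ) *
    ∫ β : ℝ, Complex.exp (-(Complex.I * (β : ℂ) * (ξ : ℂ))) * f β


lemma aux_inner_t (y : ℝ) (hy : 0 < y) :
    ∫⁻ t in Set.Ioi (0:ℝ), ENNReal.ofReal ((1 - Real.cos y) * (t * Real.exp (-(t * y))))
      = ENNReal.ofReal ((1 - Real.cos y) / y ^ 2) := by
  have h := Real.integral_rpow_mul_exp_neg_mul_Ioi (a := 2) (r := y) (by norm_num) hy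
  have h2 : ∫ t in Set.Ioi (0:ℝ), t * Real.exp (-(t * y)) = 1 / y ^ 2 := by
    have e : ∫ t in Set.Ioi (0:ℝ), t * Real.exp (-(t * y)) =
        ∫ t in Set.Ioi (0:ℝ), t ^ ((2:ℝ) - 1) * Real.exp (-(y * t)) := by
      refine setIntegral_congr_fun measurableSet_Ioi fun t ht => ?_
      norm_num [mul_comm]
    rw [e, h, Real.Gamma_two]
    norm_num
  have hi : Integrable (fun t : ℝ => t * Real.exp (-(t * y))) (volume.restrict (Set.Ioi 0)) := by
    apply Integrable.of_integral_ne_zero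
    rw [h2]; positivity
  rw [← ofReal_integral_eq_lintegral_ofReal (hi.const_mul _), integral_const_mul, h2]
  · congr 1; ring
  · refine (ae_restrict_iff' measurableSet_Ioi).2 (Filter.Eventually.of_forall fun t ht => ?_)
    have := Real.cos_le_one y
    have : (0:ℝ) < t := ht
    have h0 : 0 ≤ 1 - Real.cos y := by linarith
    simp only [Pi.zero_apply]
    positivity

lemma aux_inner_y (t : ℝ) (ht : 0 < t) :
    ∫⁻ y in Set.Ioi (0:ℝ), ENNReal.ofReal ((1 - Real.cos y) * (t * Real.exp (-(t * y))))
      = ENNReal.ofReal ((1 + t ^ 2)⁻¹) := by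
  have hpos : ∀ y : ℝ, 0 ≤ (1 - Real.cos y) * (t * Real.exp (-(t * y))) := fun y => by
    have := Real.cos_le_one y
    have h0 : 0 ≤ 1 - Real.cos y := by linarith
    positivity
  set G : ℝ → ℝ := fun y => Real.exp (-(t * y)) *
    (-1 - t * (Real.sin y - t * Real.cos y) / (1 + t ^ 2)) with hG
  have hd : ∀ y : ℝ, HasDerivAt G ((1 - Real.cos y) * (t * Real.exp (-(t * y)))) y := by
    intro y
    have h1 : HasDerivAt (fun y : ℝ => Real.exp (-(t * y))) (Real.exp (-(t * y)) * (-(t * 1))) y :=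
      (((hasDerivAt_id y).const_mul t).neg).exp
    have h2 : HasDerivAt (fun y : ℝ => -1 - t * (Real.sin y - t * Real.cos y) / (1 + t ^ 2))
        (-(t * (Real.cos y - t * (- Real.sin y)) / (1 + t ^ 2))) y :=
      ((((Real.hasDerivAt_sin y).sub ((Real.hasDerivAt_cos y).const_mul t)).const_mul t).div_const
        _).const_sub _
    refine (h1.mul h2).congr_deriv ?_
    field_simp
    ring
  have hlim : Filter.Tendsto G Filter.atTop (nhds 0) := by
    have he : Filter.Tendsto (fun y : ℝ => Real.exp (-(t * y))) Filter.atTop (nhds 0) :=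
      Real.tendsto_exp_neg_atTop_nhds_zero.comp (Filter.tendsto_id.const_mul_atTop ht)
    refine he.zero_mul_isBoundedUnder_le ?_
    refine Filter.isBoundedUnder_of ⟨1 + t * (1 + t), fun y => ?_⟩
    have hs := abs_le.1 (Real.abs_sin_le_one y)
    have hc := abs_le.1 (Real.abs_cos_le_one y)
    have hA : |t * (Real.sin y - t * Real.cos y)| ≤ t * (1 + t) := by
      rw [abs_mul, abs_of_pos ht]
      gcongr
      rw [abs_le]; constructor <;> nlinarith
    have hB : |t * (Real.sin y - t * Real.cos y) / (1 + t ^ 2)| ≤ t * (1 + t) := by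
      rw [abs_div, abs_of_pos (show 0 < 1 + t ^ 2 by positivity)]
      refine (div_le_self (abs_nonneg _) (by nlinarith)).trans hA
    simp only [Function.comp, Real.norm_eq_abs]
    rw [abs_le] at hB ⊢
    constructor <;> nlinarith
  have hi := integrableOn_Ioi_deriv_of_nonneg (a := 0) (hd 0).continuousAt.continuousWithinAt
    (fun x _ => hd x) (fun x _ => hpos x) hlim
  have hv := integral_Ioi_of_hasDerivAt_of_nonneg (a := 0) (hd 0).continuousAt.continuousWithinAt
    (fun x _ => hd x) (fun x _ => hpos x) hlim
  rw [← ofReal_integral_eq_lintegral_ofReal hi (Filter.Eventually.of_forall hpos), hv]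
  congr 1
  simp [hG]
  field_simp
  ring

lemma aux_half : ∫ y in Set.Ioi (0:ℝ), (1 - Real.cos y) / y ^ 2 = Real.pi / 2 := by
  have hnn : ∀ y : ℝ, 0 ≤ (1 - Real.cos y) / y ^ 2 := fun y => by
    have := Real.cos_le_one y
    have h0 : 0 ≤ 1 - Real.cos y := by linarith
    positivity
  rw [integral_eq_lintegral_of_nonneg_ae (Filter.Eventually.of_forall hnn)
    (by apply Measurable.aestronglyMeasurable; fun_prop)]
  rw [← setLIntegral_congr_fun measurableSet_Ioi (fun y hy => aux_inner_t y hy)]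
  rw [lintegral_lintegral_swap (by apply Measurable.aemeasurable; fun_prop)]
  rw [setLIntegral_congr_fun measurableSet_Ioi (fun y hy => aux_inner_y y hy)]
  rw [← ofReal_integral_eq_lintegral_ofReal integrable_inv_one_add_sq.integrableOn
    (Filter.Eventually.of_forall fun t => by simp only [Pi.zero_apply]; positivity)]
  rw [integral_Ioi_inv_one_add_sq]
  simp
  positivity

lemma aux_full : ∫ y : ℝ, (1 - Real.cos y) / y ^ 2 = Real.pi := by
  have h := integral_comp_abs (f := fun y : ℝ => (1 - Real.cos y) / y ^ 2)
  simp only [Real.cos_abs, sq_abs] at h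
  rw [h, aux_half]; ring

lemma aux_scaled (ξ : ℝ) : Integrable (fun y : ℝ => (1 - Real.cos (y * ξ)) / y ^ 2) ∧
    ∫ y : ℝ, (1 - Real.cos (y * ξ)) / y ^ 2 = Real.pi * |ξ| := by
  rcases eq_or_ne ξ 0 with rfl | hξ
  · simp
  have e : (fun y : ℝ => (1 - Real.cos (y * ξ)) / y ^ 2) =
      fun y => ξ ^ 2 * ((1 - Real.cos (y * ξ)) / (y * ξ) ^ 2) := by
    ext y
    rcases eq_or_ne y 0 with rfl | hy
    · simp
    field_simp
  have hv : ∫ y : ℝ, (1 - Real.cos (y * ξ)) / y ^ 2 = Real.pi * |ξ| := by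
    rw [e, integral_const_mul,
      Measure.integral_comp_mul_right (fun y : ℝ => (1 - Real.cos y) / y ^ 2) ξ, aux_full,
      ← sq_abs ξ, abs_inv, smul_eq_mul]
    have := abs_pos.2 hξ
    field_simp
  refine ⟨Integrable.of_integral_ne_zero ?_, hv⟩
  rw [hv]
  have := abs_pos.2 hξ
  positivity

lemma aux_measS (ε : ℝ) : MeasurableSet {y : ℝ | ε ≤ |y|} :=
  measurableSet_le measurable_const continuous_abs.measurable

lemma aux_intS (ε : ℝ) (hε : 0 < ε) :
    Integrable (fun y : ℝ => (y ^ 2)⁻¹) (volume.restrict {y : ℝ | ε ≤ |y|}) := by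
  have hb : Integrable (fun y : ℝ => (1 + (ε ^ 2)⁻¹) * (1 + y ^ 2)⁻¹)
      (volume.restrict {y : ℝ | ε ≤ |y|}) :=
    (integrable_inv_one_add_sq.const_mul _).integrableOn
  refine hb.mono' (by apply Measurable.aestronglyMeasurable; fun_prop) ?_
  refine (ae_restrict_iff' (aux_measS ε)).2 (Filter.Eventually.of_forall fun y hy => ?_)
  have hy' : ε ≤ |y| := hy
  have h2 : ε ^ 2 ≤ y ^ 2 := by rw [← sq_abs y]; gcongr
  have h3 : 0 < y ^ 2 := lt_of_lt_of_le (by positivity) h2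
  have hy0 : y ≠ 0 := fun h => by simp [h] at h3
  rw [Real.norm_of_nonneg (by positivity)]
  rw [← sub_nonneg]
  have : (1 + (ε ^ 2)⁻¹) * (1 + y ^ 2)⁻¹ - (y ^ 2)⁻¹ =
    (y ^ 2 - ε ^ 2) / (ε ^ 2 * y ^ 2 * (1 + y ^ 2)) := by field_simp; ring
  rw [this]
  have : 0 ≤ y ^ 2 - ε ^ 2 := by linarith
  positivity

lemma aux_kernel_norm (y ξ : ℝ) :
    ‖(1 - Complex.exp (-(Complex.I * (y : ℂ) * (ξ : ℂ)))) / ((y ^ 2 : ℝ) : ℂ)‖ ≤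
      2 * (y ^ 2)⁻¹ := by
  have h1 : ‖Complex.exp (-(Complex.I * (y : ℂ) * (ξ : ℂ)))‖ = 1 := by
    rw [Complex.norm_exp]; simp
  rw [norm_div, Complex.norm_real, Real.norm_of_nonneg (sq_nonneg y), div_eq_mul_inv]
  gcongr
  calc _ ≤ ‖(1:ℂ)‖ + ‖Complex.exp (-(Complex.I * (y : ℂ) * (ξ : ℂ)))‖ := norm_sub_le _ _
    _ = 2 := by rw [h1]; norm_num

lemma aux_kernel_int (ε : ℝ) (hε : 0 < ε) (ξ : ℝ) :
    Integrable (fun y : ℝ => (1 - Complex.exp (-(Complex.I * (y : ℂ) * (ξ : ℂ)))) /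
      ((y ^ 2 : ℝ) : ℂ)) (volume.restrict {y : ℝ | ε ≤ |y|}) :=
  ((aux_intS ε hε).const_mul 2).mono' (by apply Measurable.aestronglyMeasurable; fun_prop)
    (Filter.Eventually.of_forall fun y => aux_kernel_norm y ξ)

lemma aux_kernel (ε : ℝ) (hε : 0 < ε) (ξ : ℝ) :
    ∫ y in {y : ℝ | ε ≤ |y|}, (1 - Complex.exp (-(Complex.I * (y : ℂ) * (ξ : ℂ)))) /
      ((y ^ 2 : ℝ) : ℂ) =
    ((∫ y in {y : ℝ | ε ≤ |y|}, (1 - Real.cos (y * ξ)) / y ^ 2 : ℝ) : ℂ) := by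
  set g : ℝ → ℂ := fun y => (1 - Complex.exp (-(Complex.I * (y : ℂ) * (ξ : ℂ)))) /
      ((y ^ 2 : ℝ) : ℂ) with hg
  have hi := aux_kernel_int ε hε ξ
  have hneg : ∫ y in {y : ℝ | ε ≤ |y|}, g y = ∫ y in {y : ℝ | ε ≤ |y|}, g (-y) := by
    rw [← integral_indicator (aux_measS ε), ← integral_indicator (aux_measS ε),
      ← integral_neg_eq_self]
    congr 1
    ext y
    simp [Set.indicator]
  have hi' : Integrable (fun y => g (-y)) (volume.restrict {y : ℝ | ε ≤ |y|}) := by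
    convert aux_kernel_int ε hε (-ξ) using 2 with y
    simp [hg]
  have hs : (∫ y in {y : ℝ | ε ≤ |y|}, g y) + ∫ y in {y : ℝ | ε ≤ |y|}, g y =
      2 * ((∫ y in {y : ℝ | ε ≤ |y|}, (1 - Real.cos (y * ξ)) / y ^ 2 : ℝ) : ℂ) := by
    nth_rewrite 2 [hneg]
    rw [← integral_add hi hi', ← integral_complex_ofReal, ← integral_const_mul]
    congr 1
    ext y
    simp only [hg]
    push_cast
    rw [Complex.cos]
    rw [show -(Complex.I * (y:ℂ) * ξ) = -(y * ξ) * Complex.I by ring,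
      show -(Complex.I * -(y:ℂ) * ξ) = (y * ξ) * Complex.I by ring]
    ring
  linear_combination hs / 2

open FourierTransform in
lemma aux_fourierT_eq (f : SchwartzMap ℝ ℂ) (ξ : ℝ) :
    fourierT f ξ = ((1 / Real.sqrt (2 * Real.pi) : ℝ) : ℂ) *
      (𝓕 f) (ξ * (2 * Real.pi)⁻¹) := by
  rw [fourierT, SchwartzMap.fourier_coe, Real.fourier_real_eq_integral_exp_smul]
  congr 2
  ext β
  rw [smul_eq_mul]
  congr 2
  have : (Real.pi : ℂ) ≠ 0 := by exact_mod_cast Real.pi_ne_zero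
  push_cast
  field_simp

lemma aux_F_int (f : SchwartzMap ℝ ℂ) : Integrable (fourierT f) := by
  have : fourierT f = _ := funext (aux_fourierT_eq f)
  rw [this]
  exact ((SchwartzMap.integrable _).comp_mul_right' (by positivity)).const_mul _

open FourierTransform in
lemma aux_F_int1 (f : SchwartzMap ℝ ℂ) : Integrable (fun ξ : ℝ => |ξ| * ‖fourierT f ξ‖) := by
  have h1 := (SchwartzMap.integrable_pow_mul volume (𝓕 f) 1).comp_mul_right'
    (R := (2 * Real.pi)⁻¹) (by positivity)
  refine (h1.const_mul ((2 * Real.pi) * (1 / Real.sqrt (2 * Real.pi)))).congr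
    (Filter.Eventually.of_forall fun ξ => ?_)
  simp only [aux_fourierT_eq, norm_mul, Complex.norm_real, Real.norm_eq_abs, pow_one]
  rw [abs_of_pos (show 0 < 1 / Real.sqrt (2 * Real.pi) by positivity),
    abs_of_pos (show 0 < (2 * Real.pi)⁻¹ by positivity)]
  field_simp

open FourierTransform in
lemma aux_inv (f : SchwartzMap ℝ ℂ) (x : ℝ) :
    f x = ((1 / Real.sqrt (2 * Real.pi) : ℝ) : ℂ) *
      ∫ ξ : ℝ, Complex.exp (Complex.I * (x : ℂ) * (ξ : ℂ)) * fourierT f ξ := by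
  have h : (𝓕⁻ (𝓕 f)) x = f x := by rw [FourierTransform.fourierInv_fourier_eq]
  rw [← h, SchwartzMap.fourierInv_coe, Real.fourierInv_eq']
  simp only [aux_fourierT_eq]
  have hc := Measure.integral_comp_mul_right (fun v : ℝ =>
    Complex.exp (2 * Real.pi * Complex.I * x * v) * (𝓕 f) v) (2 * Real.pi)⁻¹
  have e : ∀ ξ : ℝ, Complex.exp (Complex.I * (x : ℂ) * (ξ : ℂ)) *
      (((1 / Real.sqrt (2 * Real.pi) : ℝ) : ℂ) * (𝓕 f) (ξ * (2 * Real.pi)⁻¹)) =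
      ((1 / Real.sqrt (2 * Real.pi) : ℝ) : ℂ) *
      (Complex.exp (2 * Real.pi * Complex.I * x * ((ξ * (2 * Real.pi)⁻¹ : ℝ) : ℂ)) *
        (𝓕 f) (ξ * (2 * Real.pi)⁻¹)) := by
    intro ξ
    have : (2 * Real.pi * Complex.I * x * ((ξ * (2 * Real.pi)⁻¹ : ℝ) : ℂ)) =
        Complex.I * (x : ℂ) * (ξ : ℂ) := by
      have : (Real.pi : ℂ) ≠ 0 := by exact_mod_cast Real.pi_ne_zero
      push_cast
      field_simp
    rw [this]; ring
  simp only [e]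
  rw [integral_const_mul, hc, inv_inv, abs_of_pos (by positivity), Complex.real_smul,
    ← mul_assoc, ← mul_assoc, ← Complex.ofReal_mul, ← Complex.ofReal_mul]
  have : 1 / Real.sqrt (2 * Real.pi) * (1 / Real.sqrt (2 * Real.pi)) * (2 * Real.pi) = 1 := by
    have h2 : (0:ℝ) < 2 * Real.pi := by positivity
    have h3 := Real.mul_self_sqrt h2.le
    have h4 := Real.sqrt_pos.2 h2
    field_simp
    nlinarith
  rw [this, Complex.ofReal_one, one_mul]
  congr 1
  ext v
  rw [smul_eq_mul]
  congr 2
  simp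
  ring

lemma aux_key (f : SchwartzMap ℝ ℂ) (α ε : ℝ) (hε : 0 < ε) :
    ∫ β in {β : ℝ | ε ≤ |α - β|}, (f α - f β) / (((α - β) ^ 2 : ℝ) : ℂ) =
    ((1 / Real.sqrt (2 * Real.pi) : ℝ) : ℂ) *
      ∫ ξ : ℝ, Complex.exp (Complex.I * (α : ℂ) * (ξ : ℂ)) * fourierT f ξ *
        ((∫ y in {y : ℝ | ε ≤ |y|}, (1 - Real.cos (y * ξ)) / y ^ 2 : ℝ) : ℂ) := by
  have hS : MeasurableSet {β : ℝ | ε ≤ |α - β|} :=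
    measurableSet_le measurable_const (by fun_prop)
  have h1 : ∫ β in {β : ℝ | ε ≤ |α - β|}, (f α - f β) / (((α - β) ^ 2 : ℝ) : ℂ) =
      ∫ y in {y : ℝ | ε ≤ |y|}, (f α - f (α - y)) / ((y ^ 2 : ℝ) : ℂ) := by
    rw [← integral_indicator hS, ← integral_indicator (aux_measS ε),
      ← integral_sub_left_eq_self _ volume α]
    congr 1
    ext y
    simp [Set.indicator]
  have hexp : ∀ x : ℝ, Integrable (fun ξ : ℝ =>
      Complex.exp (Complex.I * (x : ℂ) * (ξ : ℂ)) * fourierT f ξ) := fun x => by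
    refine (aux_F_int f).bdd_mul (c := 1) (by apply Continuous.aestronglyMeasurable; fun_prop)
      (Filter.Eventually.of_forall fun ξ => ?_)
    rw [Complex.norm_exp]; simp
  have h2 : ∀ y : ℝ, (f α - f (α - y)) / ((y ^ 2 : ℝ) : ℂ) =
      ((1 / Real.sqrt (2 * Real.pi) : ℝ) : ℂ) *
      ∫ ξ : ℝ, Complex.exp (Complex.I * (α : ℂ) * (ξ : ℂ)) * fourierT f ξ *
        ((1 - Complex.exp (-(Complex.I * (y : ℂ) * (ξ : ℂ)))) / ((y ^ 2 : ℝ) : ℂ)) := by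
    intro y
    rw [aux_inv f α, aux_inv f (α - y), ← mul_sub, ← integral_sub (hexp _) (hexp _),
      mul_div_assoc, ← integral_div]
    congr 2
    ext ξ
    rw [show Complex.I * ((α - y : ℝ) : ℂ) * (ξ : ℂ) =
      Complex.I * (α : ℂ) * (ξ : ℂ) + -(Complex.I * (y : ℂ) * (ξ : ℂ)) by push_cast; ring,
      Complex.exp_add]
    ring
  rw [h1]
  simp only [h2]
  rw [integral_const_mul, integral_integral_swap]
  · congr 2
    ext ξ
    rw [integral_const_mul, aux_kernel ε hε]
  · have hb := ((aux_intS ε hε).const_mul 2).mul_prod (aux_F_int f).norm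
    refine hb.mono' ?_ (Filter.Eventually.of_forall fun z => ?_)
    · have hF : AEStronglyMeasurable (fun z : ℝ × ℝ => fourierT f z.2)
          ((volume.restrict {y : ℝ | ε ≤ |y|}).prod volume) :=
        (aux_F_int f).aestronglyMeasurable.comp_snd
      have m1 : Measurable (fun z : ℝ × ℝ => Complex.exp (Complex.I * (α : ℂ) * (z.2 : ℂ))) := by
        fun_prop
      have m2 : Measurable (fun z : ℝ × ℝ =>
          (1 - Complex.exp (-(Complex.I * (z.1 : ℂ) * (z.2 : ℂ)))) / ((z.1 ^ 2 : ℝ) : ℂ)) := by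
        fun_prop
      exact (m1.aestronglyMeasurable.mul hF).mul m2.aestronglyMeasurable
    · have h3 : ‖Complex.exp (Complex.I * (α : ℂ) * (z.2 : ℂ))‖ = 1 := by
        rw [Complex.norm_exp]; simp
      simp only [Function.uncurry]
      rw [norm_mul, norm_mul, h3, one_mul, mul_comm]
      gcongr
      exact aux_kernel_norm _ _

lemma aux_K_nonneg (y ξ : ℝ) : 0 ≤ (1 - Real.cos (y * ξ)) / y ^ 2 := by
  have := Real.cos_le_one (y * ξ)
  have h0 : 0 ≤ 1 - Real.cos (y * ξ) := by linarith
  positivity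

lemma aux_K_le (ε ξ : ℝ) :
    ‖∫ y in {y : ℝ | ε ≤ |y|}, (1 - Real.cos (y * ξ)) / y ^ 2‖ ≤ Real.pi * |ξ| := by
  rw [Real.norm_of_nonneg (integral_nonneg fun y => aux_K_nonneg y ξ), ← (aux_scaled ξ).2]
  exact setIntegral_le_integral (aux_scaled ξ).1
    (Filter.Eventually.of_forall fun y => aux_K_nonneg y ξ)

lemma aux_K_lim (ξ : ℝ) : Filter.Tendsto
    (fun ε : ℝ => ∫ y in {y : ℝ | ε ≤ |y|}, (1 - Real.cos (y * ξ)) / y ^ 2)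
    (nhdsWithin 0 (Set.Ioi 0)) (nhds (Real.pi * |ξ|)) := by
  rw [← (aux_scaled ξ).2]
  simp only [← integral_indicator (aux_measS _)]
  refine tendsto_integral_filter_of_dominated_convergence _
    (Filter.Eventually.of_forall fun ε =>
      ((aux_scaled ξ).1.indicator (aux_measS ε)).aestronglyMeasurable)
    (Filter.Eventually.of_forall fun ε => Filter.Eventually.of_forall fun y => ?_)
    (aux_scaled ξ).1.norm (Filter.Eventually.of_forall fun y => ?_)
  · exact norm_indicator_le_norm_self _ _
  · rcases eq_or_ne y 0 with rfl | hy
    · simp [Set.indicator]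
    · refine tendsto_const_nhds.congr' ?_
      have : ∀ᶠ ε : ℝ in nhdsWithin 0 (Set.Ioi 0), ε < |y| :=
        nhdsWithin_le_nhds (Iio_mem_nhds (abs_pos.2 hy))
      filter_upwards [this] with ε hε
      rw [Set.indicator_of_mem]
      exact hε.le

theorem statement7 (f : SchwartzMap ℝ ℂ) (α : ℝ) :
    Filter.Tendsto (fun ε : ℝ =>
        ((1 / Real.pi : ℝ) : ℂ) *
          ∫ β in {β : ℝ | ε ≤ |α - β|}, (f α - f β) / (((α - β) ^ 2 : ℝ) : ℂ))
      (nhdsWithin 0 (Set.Ioi 0))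
      (nhds (((1 / Real.sqrt (2 * Real.pi) : ℝ) : ℂ) *
        ∫ ξ : ℝ, Complex.exp (Complex.I * (α : ℂ) * (ξ : ℂ)) * ((|ξ| : ℝ) : ℂ) *
          fourierT (⇑f) ξ)) := by
  have hlim : Filter.Tendsto (fun ε : ℝ =>
      ∫ ξ : ℝ, Complex.exp (Complex.I * (α : ℂ) * (ξ : ℂ)) * fourierT f ξ *
        ((∫ y in {y : ℝ | ε ≤ |y|}, (1 - Real.cos (y * ξ)) / y ^ 2 : ℝ) : ℂ))
      (nhdsWithin 0 (Set.Ioi 0))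
      (nhds (∫ ξ : ℝ, Complex.exp (Complex.I * (α : ℂ) * (ξ : ℂ)) * fourierT f ξ *
        ((Real.pi * |ξ| : ℝ) : ℂ))) := by
    have m1 : Measurable (fun ξ : ℝ => Complex.exp (Complex.I * (α : ℂ) * (ξ : ℂ))) := by
      fun_prop
    refine tendsto_integral_filter_of_dominated_convergence
      (fun ξ => Real.pi * (|ξ| * ‖fourierT f ξ‖))
      (Filter.Eventually.of_forall fun ε => ?_)
      (Filter.Eventually.of_forall fun ε => Filter.Eventually.of_forall fun ξ => ?_)
      ((aux_F_int1 f).const_mul _) (Filter.Eventually.of_forall fun ξ => ?_)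
    · refine (m1.aestronglyMeasurable.mul (aux_F_int f).aestronglyMeasurable).mul ?_
      have m2 : StronglyMeasurable (Function.uncurry fun ξ y : ℝ =>
          (1 - Real.cos (y * ξ)) / y ^ 2) := by
        apply Measurable.stronglyMeasurable
        simp only [Function.uncurry_def]
        fun_prop
      have m3 := (m2.integral_prod_right (ν := volume.restrict {y : ℝ | ε ≤ |y|})).measurable
      exact (Complex.measurable_ofReal.comp m3).aestronglyMeasurable
    · have h3 : ‖Complex.exp (Complex.I * (α : ℂ) * (ξ : ℂ))‖ = 1 := by
        rw [Complex.norm_exp]; simp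
      rw [norm_mul, norm_mul, h3, one_mul, Complex.norm_real, mul_comm, ← mul_assoc]
      gcongr
      exact aux_K_le ε ξ
    · exact ((Complex.continuous_ofReal.tendsto _).comp (aux_K_lim ξ)).const_mul _
  have h := (hlim.const_mul ((1 / Real.sqrt (2 * Real.pi) : ℝ) : ℂ)).const_mul
    ((1 / Real.pi : ℝ) : ℂ)
  have e : ((1 / Real.pi : ℝ) : ℂ) * (((1 / Real.sqrt (2 * Real.pi) : ℝ) : ℂ) *
      ∫ ξ : ℝ, Complex.exp (Complex.I * (α : ℂ) * (ξ : ℂ)) * fourierT f ξ *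
        ((Real.pi * |ξ| : ℝ) : ℂ)) = ((1 / Real.sqrt (2 * Real.pi) : ℝ) : ℂ) *
        ∫ ξ : ℝ, Complex.exp (Complex.I * (α : ℂ) * (ξ : ℂ)) * ((|ξ| : ℝ) : ℂ) *
          fourierT (⇑f) ξ := by
    rw [mul_left_comm, ← integral_const_mul]
    congr 2
    ext ξ
    have : (Real.pi : ℂ) ≠ 0 := by exact_mod_cast Real.pi_ne_zero
    push_cast
    field_simp
  rw [e] at h
  refine h.congr' ?_
  filter_upwards [self_mem_nhdsWithin] with ε hε
  rw [aux_key f α ε hε]
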